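/- A finite poset P is a semiorder (i.e., admits a unit interval representation) if and only if P contains neither 2+2 nor 3+1 as a subposet; that is, there exist no four distinct elements a, b, c, d with a < b, c < d, and each of a, b incomparable to each of c, d, and no four distinct elements a, b, c, d with a < b < c and d incomparable to each of a, b, c. -/

import Mathlib

/-- `x` and `y` are incomparable in the strict order. -/
def Incomp {α : Type*} [Preorder α] (x y : α) : Prop := ¬ x < y ∧ ¬ y < x

/-- Greedy construction along a linear order compatible with the relation. -/
theorem semi_greedy {β : Type*} [LinearOrder β] (r : β → β → Prop)
    (hlt : ∀ x y, r x y → x < y)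
    (hmono : ∀ x' x y y', x' ≤ x → y ≤ y' → r x y → r x' y') (s : Finset β) :
    ∃ f : β → ℝ, ∀ x ∈ s, ∀ y ∈ s, (x < y → f x < f y) ∧ (r x y → f x + 1 < f y) ∧
      (¬ r x y → f y < f x + 1) := by
  classical
  induction s using Finset.induction_on_max with
  | empty => exact ⟨fun _ => 0, by simp⟩
  | insert a s ha ih =>
    obtain ⟨f, hf⟩ := ih
    obtain ⟨t, ht1, ht2⟩ := Order.exists_between_finsets
      (lo := s.image f ∪ (s.filter (fun x => r x a)).image (fun x => f x + 1))
      (hi := (s.filter (fun x => ¬ r x a)).image (fun x => f x + 1)) (by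
        intro u hu v hv
        simp only [Finset.mem_union, Finset.mem_image, Finset.mem_filter] at hu hv
        obtain ⟨y, ⟨hy, hya⟩, rfl⟩ := hv
        rcases hu with ⟨x, hx, rfl⟩ | ⟨x, ⟨hx, hxa⟩, rfl⟩
        · exact (hf y hy x hx).2.2 (fun h => hya (hmono _ _ _ _ le_rfl (ha x hx).le h))
        · have hxy : x < y := by
            by_contra h
            exact hya (hmono _ _ _ _ (not_lt.1 h) le_rfl hxa)
          have := (hf x hx y hy).1 hxy
          linarith)
    have h1 : ∀ x ∈ s, f x < t := fun x hx =>
      ht1 _ (Finset.mem_union_left _ (Finset.mem_image_of_mem f hx))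
    have h2 : ∀ x ∈ s, r x a → f x + 1 < t := fun x hx h =>
      ht1 _ (Finset.mem_union_right _ (Finset.mem_image.2 ⟨x, Finset.mem_filter.2 ⟨hx, h⟩, rfl⟩))
    have h3 : ∀ x ∈ s, ¬ r x a → t < f x + 1 := fun x hx h =>
      ht2 _ (Finset.mem_image.2 ⟨x, Finset.mem_filter.2 ⟨hx, h⟩, rfl⟩)
    have hne : ∀ x ∈ s, x ≠ a := fun x hx => (ha x hx).ne
    refine ⟨Function.update f a t, ?_⟩
    intro x hx0 y hy0
    rcases Finset.mem_insert.1 hx0 with rfl | hx <;> rcases Finset.mem_insert.1 hy0 with rfl | hy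
    · refine ⟨fun h => absurd h (lt_irrefl _), fun h => absurd (hlt _ _ h) (lt_irrefl _), ?_⟩
      intro _; simp
    · rw [Function.update_self, Function.update_of_ne (hne y hy)]
      refine ⟨fun h => absurd h (ha y hy).not_gt,
        fun h => absurd (hlt _ _ h) (ha y hy).not_gt, fun _ => ?_⟩
      linarith [h1 y hy]
    · rw [Function.update_self, Function.update_of_ne (hne x hx)]
      exact ⟨fun _ => h1 x hx, h2 x hx, h3 x hx⟩
    · rw [Function.update_of_ne (hne x hx), Function.update_of_ne (hne y hy)]
      exact hf x hx y hy

theorem semi_exists {α : Type*} [Fintype α] [PartialOrder α]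
    (h22 : ∀ a b c d : α, a < b → c < d → a < d ∨ c < b)
    (h31 : ∀ a b c d : α, a < b → b < c → a < d ∨ d < c) :
    ∃ f : α → ℝ, ∀ x y : α, x < y ↔ f x + 1 < f y := by
  classical
  let D : α → Finset α := fun x => Finset.univ.filter (fun z => z < x)
  let U : α → Finset α := fun x => Finset.univ.filter (fun z => x < z)
  let c : α → ℤ := fun x => ((D x).card : ℤ) - (U x).card
  have hD : ∀ x z, z ∈ D x ↔ z < x := by simp [D]
  have hU : ∀ x z, z ∈ U x ↔ x < z := by simp [U]
  have cD : ∀ x y, c x ≤ c y → ∀ z, z < x → z < y := by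
    intro x y hc z hz
    by_contra hzy
    have hs : D y ⊂ D x := by
      refine Finset.ssubset_iff_subset_ne.2 ⟨fun w hw => ?_, fun h => ?_⟩
      · rw [hD] at *
        exact (h22 _ _ _ _ hz hw).resolve_left hzy
      · rw [← hD, ← h, hD] at hz; exact hzy hz
    have hu : U x ⊆ U y := fun w hw => by
      rw [hU] at *
      exact (h31 _ _ _ y hz hw).resolve_left hzy
    have := Finset.card_lt_card hs
    have := Finset.card_le_card hu
    simp only [c] at hc
    omega
  have cU : ∀ x y, c x ≤ c y → ∀ z, y < z → x < z := by
    intro x y hc z hz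
    by_contra hzy
    have hs : U x ⊂ U y := by
      refine Finset.ssubset_iff_subset_ne.2 ⟨fun w hw => ?_, fun h => ?_⟩
      · rw [hU] at *
        exact (h22 _ _ _ _ hz hw).resolve_right hzy
      · rw [← hU, ← h, hU] at hz; exact hzy hz
    have hu : D y ⊆ D x := fun w hw => by
      rw [hD] at *
      exact (h31 _ _ _ x hw hz).resolve_right hzy
    have := Finset.card_lt_card hs
    have := Finset.card_le_card hu
    simp only [c] at hc
    omega
  let g : α → Lex (ℤ × Fin (Fintype.card α)) := fun x => toLex (c x, Fintype.equivFin α x)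
  have hg : Function.Injective g := by
    intro x y h
    have h' := congrArg (fun p => (ofLex p).2) h
    exact (Fintype.equivFin α).injective h'
  have hgc : ∀ x y, g x ≤ g y → c x ≤ c y := by
    intro x y h
    rcases Prod.Lex.toLex_le_toLex.1 h with h | h
    · exact h.le
    · exact h.1.le
  obtain ⟨f, hf⟩ := @semi_greedy α (LinearOrder.lift' g hg) (fun x y => x < y)
    (by
      intro x y hxy
      change g x < g y
      by_contra h
      exact lt_irrefl _ (cD _ _ (hgc _ _ (not_lt.1 h)) x hxy))
    (by
      intro x' x y y' hx hy h
      exact cD _ _ (hgc _ _ hy) _ (cU _ _ (hgc _ _ hx) _ h)) Finset.univ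
  refine ⟨f, fun x y => ⟨(hf x (Finset.mem_univ _) y (Finset.mem_univ _)).2.1, fun h => ?_⟩⟩
  by_contra hn
  exact lt_asymm h ((hf x (Finset.mem_univ _) y (Finset.mem_univ _)).2.2 hn)

/-- A finite poset is a semiorder (admits a unit interval representation)
if and only if it contains neither `2 + 2` nor `3 + 1`. -/
theorem semiorder_iff_no_two_plus_two_and_no_three_plus_one
    {α : Type*} [Fintype α] [PartialOrder α] :
    (∃ f : α → ℝ, ∀ x y : α, x < y ↔ f x + 1 < f y) ↔
      ((¬ ∃ a b c d : α,
          a ≠ b ∧ a ≠ c ∧ a ≠ d ∧ b ≠ c ∧ b ≠ d ∧ c ≠ d ∧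
          a < b ∧ c < d ∧
          Incomp a c ∧ Incomp a d ∧ Incomp b c ∧ Incomp b d) ∧
        (¬ ∃ a b c d : α,
          a ≠ b ∧ a ≠ c ∧ a ≠ d ∧ b ≠ c ∧ b ≠ d ∧ c ≠ d ∧
          a < b ∧ b < c ∧
          Incomp d a ∧ Incomp d b ∧ Incomp d c)) := by
  constructor
  · rintro ⟨f, hf⟩
    constructor
    · rintro ⟨a, b, c, d, -, -, -, -, -, -, hab, hcd, -, had, hbc, -⟩
      have h1 := had.1
      have h2 := hbc.2
      rw [hf] at hab hcd h1 h2
      linarith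
    · rintro ⟨a, b, c, d, -, -, -, -, -, -, hab, hbc, hda, -, hdc⟩
      have h1 := hda.2
      have h2 := hdc.1
      rw [hf] at hab hbc h1 h2
      linarith
  · rintro ⟨h22, h31⟩
    apply semi_exists
    · intro a b c d hab hcd
      by_contra! h
      obtain ⟨had, hcb⟩ := h
      have hac : Incomp a c := ⟨fun h => had (h.trans hcd), fun h => hcb (h.trans hab)⟩
      have had' : Incomp a d := ⟨had, fun h => hcb (hcd.trans (h.trans hab))⟩
      have hbc : Incomp b c := ⟨fun h => had (hab.trans (h.trans hcd)), hcb⟩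
      have hbd : Incomp b d := ⟨fun h => had (hab.trans h), fun h => hcb (hcd.trans h)⟩
      refine h22 ⟨a, b, c, d, hab.ne, ?_, ?_, ?_, ?_, hcd.ne, hab, hcd, hac, had', hbc, hbd⟩
      · rintro rfl; exact had hcd
      · rintro rfl; exact hcb (hcd.trans hab)
      · rintro rfl; exact had (hab.trans hcd)
      · rintro rfl; exact had hab
    · intro a b c d hab hbc
      by_contra! h
      obtain ⟨had, hdc⟩ := h
      have hda : Incomp d a := ⟨fun h => hdc (h.trans (hab.trans hbc)), had⟩
      have hdb : Incomp d b := ⟨fun h => hdc (h.trans hbc), fun h => had (hab.trans h)⟩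
      have hdc' : Incomp d c := ⟨hdc, fun h => had (hab.trans (hbc.trans h))⟩
      refine h31 ⟨a, b, c, d, hab.ne, (hab.trans hbc).ne, ?_, hbc.ne, ?_, ?_, hab, hbc,
        hda, hdb, hdc'⟩
      · rintro rfl; exact hdc (hab.trans hbc)
      · rintro rfl; exact had hab
      · rintro rfl; exact had (hab.trans hbc)
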